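/- arXiv:2302.14449 — 8 statements merged into one kernel-verified Lean document; each statement's English description precedes it below -/
import Mathlib

section
/- The function ω(R) = 2R² arcsin(1/(2R)) − √(R² − 1/4), defined for R ≥ 1/2, is strictly decreasing on [1/2, ∞), satisfies ω(1/2) = π/4, and ω(R) → 0 as R → ∞. Consequently, for each ω ∈ (0, π/4] there is a unique R ∈ [1/2, ∞) with 2R² arcsin(1/(2R)) − √(R² − 1/4) = ω. -/
open Real Filter
open scoped Real

/-- The half-area of the symmetric lens formed by two intersecting circles of equal
radii `R`. -/
noncomputable def lensArea (R : ℝ) : ℝ :=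
  2 * R^2 * Real.arcsin (1/(2*R)) - Real.sqrt (R^2 - 1/4)

lemma sqrt_one_sub_sq_inv_two_mul {R : ℝ} (hR : 0 < R) :
    √(1 - (1 / (2 * R)) ^ 2) = √(R ^ 2 - 1 / 4) / R := by
  rw [show 1 - (1 / (2 * R)) ^ 2 = (R ^ 2 - 1 / 4) / R ^ 2 by field_simp; ring,
    Real.sqrt_div' _ (sq_nonneg R), Real.sqrt_sq hR.le]

lemma sqrt_sq_sub_quarter_pos {R : ℝ} (hR : 1 / 2 < R) : 0 < √(R ^ 2 - 1 / 4) :=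
  Real.sqrt_pos.2 (by nlinarith)

lemma one_div_two_mul_lt_one {R : ℝ} (hR : 1 / 2 < R) : 1 / (2 * R) < 1 := by
  rw [div_lt_one (by linarith)]
  linarith

lemma arcsin_inv_two_mul_lt {R : ℝ} (hR : 1 / 2 < R) :
    arcsin (1 / (2 * R)) < 1 / (2 * √(R ^ 2 - 1 / 4)) := by
  have hR0 : 0 < R := by linarith
  have hs := sqrt_sq_sub_quarter_pos hR
  have h := Real.lt_tan (Real.arcsin_pos.2 (show 0 < 1 / (2 * R) by positivity))
    (Real.arcsin_lt_pi_div_two.2 (one_div_two_mul_lt_one hR))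
  rw [Real.tan_arcsin, sqrt_one_sub_sq_inv_two_mul hR0] at h
  convert h using 1
  field_simp

lemma inv_two_mul_le_arcsin {R : ℝ} (hR : 1 / 2 < R) :
    1 / (2 * R) ≤ arcsin (1 / (2 * R)) := by
  have hpos : 0 < 1 / (2 * R) := by
    have : 0 < R := by linarith
    positivity
  have h := Real.sin_le (Real.arcsin_nonneg.2 hpos.le)
  rwa [Real.sin_arcsin (by linarith) (one_div_two_mul_lt_one hR).le] at h

lemma hasDerivAt_lensArea {R : ℝ} (hR : 1 / 2 < R) :
    HasDerivAt lensArea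
      (4 * R * (arcsin (1 / (2 * R)) - 1 / (2 * √(R ^ 2 - 1 / 4)))) R := by
  have hR0 : 0 < R := by linarith
  have hs := sqrt_sq_sub_quarter_pos hR
  have hinv : HasDerivAt (fun x : ℝ => 1 / (2 * x)) (-1 / (2 * R ^ 2)) R := by
    refine ((hasDerivAt_const R (1 : ℝ)).div ((hasDerivAt_id' R).const_mul 2)
      (by positivity)).congr_deriv ?_
    field_simp
    norm_num
  have harcsin := (Real.hasDerivAt_arcsin (x := 1 / (2 * R))
    (by have : 0 < 1 / (2 * R) := by positivity
        linarith) (one_div_two_mul_lt_one hR).ne).comp R hinv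
  have hsq : HasDerivAt (fun x : ℝ => x ^ 2) (2 * R) R := by
    simpa using hasDerivAt_pow 2 R
  have hsqrt := (hsq.sub_const (1 / 4)).sqrt (Real.sqrt_pos.1 hs).ne'
  rw [sqrt_one_sub_sq_inv_two_mul hR0] at harcsin
  refine (((hsq.const_mul 2).mul harcsin).sub hsqrt).congr_deriv ?_
  simp only [Function.comp_apply]
  field_simp
  ring

lemma continuousOn_lensArea : ContinuousOn lensArea (Set.Ici (1 / 2)) := by
  unfold lensArea
  have hinv : ContinuousOn (fun R : ℝ => 1 / (2 * R)) (Set.Ici (1 / 2)) :=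
    continuousOn_const.div (by fun_prop) fun R (hR : 1 / 2 ≤ R) => by
      have : 0 < R := by linarith
      positivity
  have harcsin := Real.continuous_arcsin.comp_continuousOn hinv
  exact (ContinuousOn.mul (by fun_prop) harcsin).sub (by fun_prop)

lemma strictAntiOn_lensArea : StrictAntiOn lensArea (Set.Ici (1 / 2)) := by
  refine strictAntiOn_of_deriv_neg (convex_Ici _) continuousOn_lensArea fun R hR => ?_
  rw [interior_Ici] at hR
  have hR' : 1 / 2 < R := hR
  rw [(hasDerivAt_lensArea hR').deriv]
  exact mul_neg_of_pos_of_neg (by linarith) (sub_neg.2 (arcsin_inv_two_mul_lt hR'))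

lemma lensArea_half : lensArea (1 / 2) = π / 4 := by
  norm_num [lensArea]
  ring

lemma lensArea_nonneg {R : ℝ} (hR : 1 / 2 < R) : 0 ≤ lensArea R := by
  have hR0 : 0 < R := by linarith
  have h := mul_le_mul_of_nonneg_left (inv_two_mul_le_arcsin hR)
    (show 0 ≤ 2 * R ^ 2 by positivity)
  have hs : √(R ^ 2 - 1 / 4) ≤ R := Real.sqrt_le_iff.2 ⟨hR0.le, by linarith⟩
  rw [show 2 * R ^ 2 * (1 / (2 * R)) = R by field_simp] at h
  unfold lensArea
  linarith

lemma lensArea_le {R : ℝ} (hR : 1 / 2 < R) : lensArea R ≤ 1 / 4 / √(R ^ 2 - 1 / 4) := by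
  have hs := sqrt_sq_sub_quarter_pos hR
  have hsq := Real.sq_sqrt (Real.sqrt_pos.1 hs).le
  have h := mul_le_mul_of_nonneg_left (arcsin_inv_two_mul_lt hR).le
    (show 0 ≤ 2 * R ^ 2 by positivity)
  have heq : 2 * R ^ 2 * (1 / (2 * √(R ^ 2 - 1 / 4))) - √(R ^ 2 - 1 / 4)
      = 1 / 4 / √(R ^ 2 - 1 / 4) := by
    have hmul : 2 * R ^ 2 * (1 / (2 * √(R ^ 2 - 1 / 4))) * √(R ^ 2 - 1 / 4) = R ^ 2 := by
      generalize √(R ^ 2 - 1 / 4) = s at hs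
      field_simp
    rw [eq_div_iff hs.ne', sub_mul, ← sq, hsq, hmul]
    ring
  unfold lensArea
  linarith

lemma tendsto_lensArea_atTop : Tendsto lensArea atTop (nhds 0) := by
  have hsqrt : Tendsto (fun R : ℝ => √(R ^ 2 - 1 / 4)) atTop atTop :=
    Real.tendsto_sqrt_atTop.comp
      (tendsto_atTop_add_const_right _ _ (tendsto_pow_atTop two_ne_zero))
  refine tendsto_of_tendsto_of_tendsto_of_le_of_le' tendsto_const_nhds
    (hsqrt.const_div_atTop (1 / 4)) ?_ ?_
  · filter_upwards [eventually_gt_atTop (1 / 2)] with R hR using lensArea_nonneg hR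
  · filter_upwards [eventually_gt_atTop (1 / 2)] with R hR using lensArea_le hR

/-- The function `ω(R) = 2R² arcsin(1/(2R)) − √(R² − 1/4)` is strictly
decreasing on `[1/2, ∞)`, equals `π/4` at `R = 1/2`, and tends to `0` as `R → ∞`;
consequently for each `ω ∈ (0, π/4]` there is a unique `R ∈ [1/2, ∞)` with
`lensArea R = ω`. -/
theorem lensArea_strictAnti_bijective :
    StrictAntiOn lensArea (Set.Ici (1/2 : ℝ)) ∧
    lensArea (1/2) = π/4 ∧
    Tendsto lensArea atTop (nhds 0) ∧
    ∀ ω ∈ Set.Ioc (0:ℝ) (π/4), ∃! R : ℝ, R ∈ Set.Ici (1/2 : ℝ) ∧ lensArea R = ω := by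
  refine ⟨strictAntiOn_lensArea, lensArea_half, tendsto_lensArea_atTop, fun ω hω => ?_⟩
  obtain ⟨M, hM, hMω⟩ := ((eventually_ge_atTop (1 / 2)).and
    (tendsto_lensArea_atTop.eventually_lt_const hω.1)).exists
  obtain ⟨R, hR, hRω⟩ := intermediate_value_Icc' hM
    (continuousOn_lensArea.mono Set.Icc_subset_Ici_self)
    ⟨hMω.le, hω.2.trans_eq lensArea_half.symm⟩
  exact ⟨R, ⟨hR.1, hRω⟩, fun S hS =>
    strictAntiOn_lensArea.injOn hS.1 hR.1 (hS.2.trans hRω.symm)⟩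
end

section
/- Let V > 0 and define g(v) = (1 + v/(20π)) (36π v²)^{1/3} for v > 0 and h(v) = g(v) + g(V − v) for v ∈ (0, V). If V > 8π, then v = V/2 is a strict local minimum of h on (0, V); if 0 < V < 8π, then v = V/2 is a strict local maximum of h on (0, V). In terms of the fissility parameter χ = V/(40π), the equal-volume two-ball configuration is a local minimizer among such splittings exactly when χ > χ₁ := 1/5. -/
open Real
open scoped Real

/-- Liquid drop energy `g(v) = (1 + v/(20π))(36π v²)^{1/3}` of a single ball of
volume `v` in `ℝ³`. -/
noncomputable def ballEnergy (v : ℝ) : ℝ := (1 + v/(20*π)) * (36*π*v^2) ^ ((1:ℝ)/3)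

theorem ballEnergy_eq_rpow {v : ℝ} (hv : 0 < v) :
    ballEnergy v = (36*π) ^ ((1:ℝ)/3) * (v ^ ((2:ℝ)/3) + v ^ ((5:ℝ)/3) / (20*π)) := by
  have hsq : (v ^ 2) ^ ((1:ℝ)/3) = v ^ ((2:ℝ)/3) := by
    rw [← rpow_natCast, ← rpow_mul hv.le]
    norm_num
  have hsplit : v ^ ((5:ℝ)/3) = v ^ ((2:ℝ)/3) * v := by
    rw [← rpow_add_one hv.ne']
    norm_num
  rw [ballEnergy, mul_rpow (by positivity) (by positivity), hsq, hsplit]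
  ring

theorem deriv_ballEnergy {v : ℝ} (hv : 0 < v) :
    deriv ballEnergy v = (36*π) ^ ((1:ℝ)/3) *
      (2/3 * v ^ (-(1:ℝ)/3) + 5/3 * v ^ ((2:ℝ)/3) / (20*π)) := by
  have heq : ballEnergy =ᶠ[nhds v] fun v =>
      (36*π) ^ ((1:ℝ)/3) * (v ^ ((2:ℝ)/3) + v ^ ((5:ℝ)/3) / (20*π)) := by
    filter_upwards [Ioi_mem_nhds hv] with w hw using ballEnergy_eq_rpow hw
  have hderiv := (((hasDerivAt_rpow_const (p := (2:ℝ)/3) (Or.inl hv.ne')).add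
    ((hasDerivAt_rpow_const (p := (5:ℝ)/3) (Or.inl hv.ne')).div_const (20*π))).const_mul
      ((36*π) ^ ((1:ℝ)/3))).congr_of_eventuallyEq heq
  rw [hderiv.deriv]
  norm_num

theorem deriv2_ballEnergy {v : ℝ} (hv : 0 < v) :
    deriv^[2] ballEnergy v =
      (36*π) ^ ((1:ℝ)/3) * v ^ (-(4:ℝ)/3) * (v - 4*π) / (18*π) := by
  have heq : deriv ballEnergy =ᶠ[nhds v] fun v => (36*π) ^ ((1:ℝ)/3) *
      (2/3 * v ^ (-(1:ℝ)/3) + 5/3 * v ^ ((2:ℝ)/3) / (20*π)) := by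
    filter_upwards [Ioi_mem_nhds hv] with w hw using deriv_ballEnergy hw
  have hderiv := ((((hasDerivAt_rpow_const (p := -(1:ℝ)/3) (Or.inl hv.ne')).const_mul (2/3)).add
    (((hasDerivAt_rpow_const (p := (2:ℝ)/3) (Or.inl hv.ne')).const_mul (5/3)).div_const
      (20*π))).const_mul ((36*π) ^ ((1:ℝ)/3))).congr_of_eventuallyEq heq
  have hsplit : v ^ ((2:ℝ)/3 - 1) = v ^ (-(4:ℝ)/3) * v := by
    rw [← rpow_add_one hv.ne']
    norm_num
  have hexp : -(1:ℝ)/3 - 1 = -(4:ℝ)/3 := by norm_num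
  change deriv (deriv ballEnergy) v = _
  rw [hderiv.deriv, hsplit, hexp]
  field_simp
  ring

theorem continuous_ballEnergy : Continuous ballEnergy := by
  unfold ballEnergy
  exact (by fun_prop : Continuous fun v : ℝ => 1 + v/(20*π)).mul
    ((by fun_prop : Continuous fun v : ℝ => 36*π*v^2).rpow_const fun _ => Or.inr (by norm_num))

theorem strictConvexOn_ballEnergy : StrictConvexOn ℝ (Set.Ici (4*π)) ballEnergy := by
  refine strictConvexOn_of_deriv2_pos (convex_Ici _) continuous_ballEnergy.continuousOn ?_
  intro v hv
  rw [interior_Ici, Set.mem_Ioi] at hv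
  have hv0 : 0 < v := lt_trans (by positivity) hv
  have hgap : 0 < v - 4*π := sub_pos.2 hv
  rw [deriv2_ballEnergy hv0]
  positivity

theorem strictConcaveOn_ballEnergy : StrictConcaveOn ℝ (Set.Icc 0 (4*π)) ballEnergy := by
  refine strictConcaveOn_of_deriv2_neg (convex_Icc _ _) continuous_ballEnergy.continuousOn ?_
  intro v hv
  rw [interior_Icc, Set.mem_Ioo] at hv
  obtain ⟨hv0, hv4⟩ := hv
  rw [deriv2_ballEnergy hv0]
  exact div_neg_of_neg_of_pos (mul_neg_of_pos_of_neg (by positivity) (sub_neg.2 hv4))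
    (by positivity)

/-- For the two-ball energy `h(v) = g(v) + g(V − v)` on `(0, V)`:
if `V > 8π` then `v = V/2` is a strict local minimum of `h` on `(0,V)`; if `0 < V < 8π`
then `v = V/2` is a strict local maximum; and in terms of the fissility parameter
`χ = V/(40π)`, the equal-volume splitting is locally minimizing exactly when
`χ > χ₁ = 1/5`. -/
theorem twoBall_equal_split_stability (V : ℝ) (hV : 0 < V)
    (h : ℝ → ℝ) (hh : h = fun v => ballEnergy v + ballEnergy (V - v)) :
    (8*π < V → ∃ δ > 0, ∀ v ∈ Set.Ioo (0:ℝ) V, v ≠ V/2 → |v - V/2| < δ →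
      h (V/2) < h v) ∧
    (V < 8*π → ∃ δ > 0, ∀ v ∈ Set.Ioo (0:ℝ) V, v ≠ V/2 → |v - V/2| < δ →
      h v < h (V/2)) ∧
    (V/(40*π) > 1/5 ↔ 8*π < V) := by
  subst hh
  have hhalf : V - V/2 = V/2 := by ring
  have hmid (v : ℝ) : (1/2 : ℝ) • v + (1/2 : ℝ) • (V - v) = V/2 := by
    simp only [smul_eq_mul]
    ring
  have hne_symm {v : ℝ} (hne : v ≠ V/2) : v ≠ V - v := fun heq => hne (by linarith)
  refine ⟨fun hlt => ⟨V/2 - 4*π, by linarith, ?_⟩, fun hlt => ⟨4*π - V/2, by linarith, ?_⟩, ?_⟩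
  · intro v _ hne hdist
    obtain ⟨hleft, hright⟩ := abs_lt.1 hdist
    have hconv := strictConvexOn_ballEnergy.2 (x := v) (y := V - v)
      (Set.mem_Ici.2 (by linarith)) (Set.mem_Ici.2 (by linarith)) (hne_symm hne)
      (one_half_pos (α := ℝ)) one_half_pos (add_halves 1)
    rw [hmid, smul_eq_mul, smul_eq_mul] at hconv
    simp only [hhalf]
    linarith
  · intro v hv hne hdist
    obtain ⟨hleft, hright⟩ := abs_lt.1 hdist
    have hconc := strictConcaveOn_ballEnergy.2 (x := v) (y := V - v)
      ⟨hv.1.le, by linarith⟩ ⟨by linarith [hv.2], by linarith⟩ (hne_symm hne)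
      (one_half_pos (α := ℝ)) one_half_pos (add_halves 1)
    rw [hmid, smul_eq_mul, smul_eq_mul] at hconc
    simp only [hhalf]
    linarith
  · rw [gt_iff_lt, lt_div_iff₀ (by positivity), show (1/5 : ℝ) * (40*π) = 8*π by ring]
end

section
/- Define p : (0, 2π) → ℝ by 16 p(θ) = 6 A(θ) sin θ + (6 + 8 ln 2)(1 − cos θ) + 5(θ − π) sin θ + (5 cos θ − 4) ln(5 − 4 cos θ), where A(θ) = arctan(1/(3 tan(θ/2))) for θ ≠ π and A(π) sin π is interpreted as 0. Then p is twice differentiable on (0, 2π) and satisfies the ordinary differential equation p(θ) + p''(θ) + ln(5 − 4 cos θ)/4 = (1 + 4 ln 2)/8 for all θ ∈ (0, 2π). -/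
open Real
open scoped Real

/-- First-order shape correction `p` for two touching disks in the 2-D liquid drop
model. Here `arctan (1/(3 tan (θ/2)))` realizes the odd branch of
`arccot (3 tan (θ/2))`; at `θ = π` Lean's conventions (`tan (π/2) = 0`, `1/0 = 0`,
`arctan 0 = 0`) give the correct value `0`, and in any case the term is multiplied
by `sin θ` which vanishes at `θ = π`. -/
noncomputable def pTouch (θ : ℝ) : ℝ :=
  (6 * Real.arctan (1/(3 * Real.tan (θ/2))) * Real.sin θ
    + (6 + 8*Real.log 2) * (1 - Real.cos θ)
    + 5*(θ - π) * Real.sin θ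
    + (5*Real.cos θ - 4) * Real.log (5 - 4*Real.cos θ)) / 16

theorem five_sub_four_mul_cos_pos (θ : ℝ) : 0 < 5 - 4 * cos θ := by
  linarith [cos_le_one θ]

theorem hasDerivAt_log_five_sub_four_mul_cos (θ : ℝ) :
    HasDerivAt (fun x => log (5 - 4 * cos x)) (4 * sin θ / (5 - 4 * cos θ)) θ := by
  have h := (((hasDerivAt_cos θ).const_mul 4).const_sub 5).log (five_sub_four_mul_cos_pos θ).ne'
  convert h using 1
  ring

theorem hasDerivAt_arctan_one_div_three_mul_tan_half {θ : ℝ} (hθ : θ ∈ Set.Ioo (0 : ℝ) (2 * π)) :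
    HasDerivAt (fun x => arctan (1 / (3 * tan (x / 2)))) (-(3 / 2) / (5 - 4 * cos θ)) θ := by
  have hs : sin (θ / 2) ≠ 0 :=
    (sin_pos_of_pos_of_lt_pi (by linarith [hθ.1]) (by linarith [hθ.2])).ne'
  have hfun : (fun x : ℝ => arctan (1 / (3 * tan (x / 2)))) =
      fun x => arctan (cos (x / 2) / (3 * sin (x / 2))) := by
    funext x
    rw [tan_eq_sin_div_cos, mul_div_assoc', one_div_div]
  rw [hfun]
  have hhalf : HasDerivAt (fun x : ℝ => x / 2) (1 / 2) θ := (hasDerivAt_id θ).div_const 2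
  have h := (hhalf.cos.div (hhalf.sin.const_mul 3) (mul_ne_zero three_ne_zero hs)).arctan
  refine h.congr_deriv ?_
  have hsc := sin_sq_add_cos_sq (θ / 2)
  have hD : 5 - 4 * cos θ = 9 * sin (θ / 2) ^ 2 + cos (θ / 2) ^ 2 := by
    have hcos : cos θ = 2 * cos (θ / 2) ^ 2 - 1 := by rw [← cos_two_mul]; ring_nf
    linear_combination -4 * hcos - 9 * hsc
  have hpos : 9 * sin (θ / 2) ^ 2 + cos (θ / 2) ^ 2 ≠ 0 := hD ▸ (five_sub_four_mul_cos_pos θ).ne'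
  have hone : 1 + (cos (θ / 2) / (3 * sin (θ / 2))) ^ 2 =
      (9 * sin (θ / 2) ^ 2 + cos (θ / 2) ^ 2) / (9 * sin (θ / 2) ^ 2) := by
    field_simp
    ring
  simp only [Pi.div_apply]
  rw [hone, hD]
  field_simp
  linear_combination -9 * hsc

/-- The derivative of `pTouch` on `(0, 2π)`. -/
noncomputable def pTouchDeriv (θ : ℝ) : ℝ :=
  (6 * arctan (1 / (3 * tan (θ / 2))) * cos θ + (6 + 8 * log 2) * sin θ
    + 5 * (θ - π) * cos θ - 5 * sin θ * log (5 - 4 * cos θ)) / 16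

theorem hasDerivAt_pTouch {θ : ℝ} (hθ : θ ∈ Set.Ioo (0 : ℝ) (2 * π)) :
    HasDerivAt pTouch (pTouchDeriv θ) θ := by
  have hD := (five_sub_four_mul_cos_pos θ).ne'
  have h := ((((((hasDerivAt_arctan_one_div_three_mul_tan_half hθ).const_mul 6).mul
    (hasDerivAt_sin θ)).add (((hasDerivAt_cos θ).const_sub 1).const_mul (6 + 8 * log 2))).add
    ((((hasDerivAt_id θ).sub_const π).const_mul 5).mul (hasDerivAt_sin θ))).add
    ((((hasDerivAt_cos θ).const_mul 5).sub_const 4).mul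
      (hasDerivAt_log_five_sub_four_mul_cos θ))).div_const 16
  refine HasDerivAt.congr_deriv (f := pTouch) h ?_
  simp only [pTouchDeriv, id]
  field_simp
  ring

theorem hasDerivAt_pTouchDeriv {θ : ℝ} (hθ : θ ∈ Set.Ioo (0 : ℝ) (2 * π)) :
    HasDerivAt pTouchDeriv
      ((1 + 4 * log 2) / 8 - log (5 - 4 * cos θ) / 4 - pTouch θ) θ := by
  have hD := (five_sub_four_mul_cos_pos θ).ne'
  have h := ((((((hasDerivAt_arctan_one_div_three_mul_tan_half hθ).const_mul 6).mul
    (hasDerivAt_cos θ)).add ((hasDerivAt_sin θ).const_mul (6 + 8 * log 2))).add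
    ((((hasDerivAt_id θ).sub_const π).const_mul 5).mul (hasDerivAt_cos θ))).sub
    (((hasDerivAt_sin θ).const_mul 5).mul
      (hasDerivAt_log_five_sub_four_mul_cos θ))).div_const 16
  refine HasDerivAt.congr_deriv (f := pTouchDeriv) h ?_
  simp only [pTouch, id]
  field_simp
  ring_nf
  rw [sin_sq]
  ring

/-- `p` is twice differentiable on `(0, 2π)` and satisfies the ODE
`p + p'' + ln(5 − 4cos θ)/4 = (1 + 4 ln 2)/8` there. -/
theorem pTouch_ode : ∀ θ ∈ Set.Ioo (0:ℝ) (2*π),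
    DifferentiableAt ℝ pTouch θ ∧
    DifferentiableAt ℝ (deriv pTouch) θ ∧
    pTouch θ + deriv (deriv pTouch) θ + Real.log (5 - 4*Real.cos θ)/4
      = (1 + 4*Real.log 2)/8 := by
  intro θ hθ
  have hderiv : HasDerivAt (deriv pTouch)
      ((1 + 4 * log 2) / 8 - log (5 - 4 * cos θ) / 4 - pTouch θ) θ :=
    (hasDerivAt_pTouchDeriv hθ).congr_of_eventuallyEq <| by
      filter_upwards [isOpen_Ioo.mem_nhds hθ] with x hx using (hasDerivAt_pTouch hx).deriv
  refine ⟨(hasDerivAt_pTouch hθ).differentiableAt, hderiv.differentiableAt, ?_⟩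
  rw [hderiv.deriv]
  ring
end

section
/- Define p : (0, 2π) → ℝ by 16 p(θ) = 6 A(θ) sin θ + (6 + 8 ln 2)(1 − cos θ) + 5(θ − π) sin θ + (5 cos θ − 4) ln(5 − 4 cos θ), where A(θ) = arctan(1/(3 tan(θ/2))) for θ ≠ π and A(π) sin π is interpreted as 0. Then lim_{θ→0⁺} p(θ) = 0, lim_{θ→0⁺} p(θ)/θ = −π/8, and lim_{θ→2π⁻} p(θ)/(θ − 2π) = π/8. Hence the one-sided derivatives of p at the endpoints are ∂₊p(0) = −π/8 and ∂₋p(2π) = π/8, so the angle formed at the touching point by the perturbed boundary ρ = 1 + ε p and its mirror image is ε π/4 + o(ε). -/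
open Real Filter
open scoped Real Topology

theorem pTouch_two_pi_sub (θ : ℝ) : pTouch (2 * π - θ) = pTouch θ := by
  have htan : Real.tan ((2 * π - θ) / 2) = -Real.tan (θ / 2) := by
    rw [show (2 * π - θ) / 2 = π - θ / 2 by ring, Real.tan_pi_sub]
  have harctan : Real.arctan (1 / (3 * -Real.tan (θ / 2)))
      = -Real.arctan (1 / (3 * Real.tan (θ / 2))) := by
    rw [← Real.arctan_neg, mul_neg, div_neg]
  unfold pTouch
  rw [htan, harctan, Real.sin_two_pi_sub, Real.cos_two_pi_sub]
  ring

theorem tendsto_arctan_one_div_three_mul_tan_half :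
    Tendsto (fun θ : ℝ => Real.arctan (1 / (3 * Real.tan (θ / 2)))) (𝓝[>] 0) (𝓝 (π / 2)) := by
  have htan : Tendsto (fun θ : ℝ => 3 * Real.tan (θ / 2)) (𝓝[>] 0) (𝓝[>] 0) := by
    refine tendsto_nhdsWithin_iff.mpr ⟨?_, ?_⟩
    · have hcont : ContinuousAt (fun θ : ℝ => 3 * Real.tan (θ / 2)) 0 := by
        refine continuousAt_const.mul (ContinuousAt.comp (g := Real.tan) ?_ (by fun_prop))
        exact Real.continuousAt_tan.mpr (by simp)
      simpa using hcont.tendsto.mono_left nhdsWithin_le_nhds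
    · filter_upwards [Ioo_mem_nhdsGT Real.pi_pos] with θ hθ
      have := Real.tan_pos_of_pos_of_lt_pi_div_two (x := θ / 2) (by linarith [hθ.1])
        (by linarith [hθ.2])
      simpa using this
  have hinv := tendsto_inv_nhdsGT_zero.comp htan
  simpa [Function.comp_def] using
    (Real.tendsto_arctan_atTop.mono_right nhdsWithin_le_nhds).comp hinv

/-- The terms of `16 p` without a factor `sin θ` vanish to second order at `0`. -/
theorem hasDerivAt_pTouch_even_part :
    HasDerivAt (fun θ : ℝ => (6 + 8 * Real.log 2) * (1 - Real.cos θ)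
      + (5 * Real.cos θ - 4) * Real.log (5 - 4 * Real.cos θ)) 0 0 := by
  have hcos := Real.hasDerivAt_cos 0
  have hlog := ((hcos.const_mul 4).const_sub 5).log (by norm_num)
  refine (((hcos.const_sub 1).const_mul (6 + 8 * Real.log 2)).add
    (((hcos.const_mul 5).sub_const 4).mul hlog)).congr_deriv ?_
  simp

theorem tendsto_pTouch_div_self :
    Tendsto (fun θ => pTouch θ / θ) (𝓝[>] (0 : ℝ)) (𝓝 (-(π / 8))) := by
  have hsin : Tendsto (fun θ : ℝ => Real.sin θ / θ) (𝓝[>] 0) (𝓝 1) := by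
    simpa [div_eq_inv_mul] using (Real.hasDerivAt_sin 0).tendsto_slope_zero_right
  have heven := hasDerivAt_pTouch_even_part.tendsto_slope_zero_right
  have hlin : Tendsto (fun θ : ℝ => 5 * (θ - π)) (𝓝[>] 0) (𝓝 (5 * (0 - π))) :=
    (Continuous.tendsto (by fun_prop) 0).mono_left nhdsWithin_le_nhds
  have hsum := (((((tendsto_arctan_one_div_three_mul_tan_half.const_mul 6).add hlin).mul
    hsin).add heven).div_const 16)
  convert hsum using 2 with θ
  · norm_num [pTouch]
    ring
  · ring

/-- `p(θ) → 0` as `θ → 0⁺`, the one-sided derivatives of `p` at the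
endpoints are `∂₊p(0) = lim_{θ→0⁺} p(θ)/θ = −π/8` and
`∂₋p(2π) = lim_{θ→2π⁻} p(θ)/(θ−2π) = π/8`; hence the perturbed boundary
`ρ = 1 + εp` and its mirror image form an angle `επ/4 + o(ε)` at the touching
point. -/
theorem pTouch_endpoint_derivs :
    Tendsto pTouch (𝓝[>] (0:ℝ)) (𝓝 0) ∧
    Tendsto (fun θ => pTouch θ / θ) (𝓝[>] (0:ℝ)) (𝓝 (-(π/8))) ∧
    Tendsto (fun θ => pTouch θ / (θ - 2*π)) (𝓝[<] (2*π)) (𝓝 (π/8)) := by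
  have hright := tendsto_pTouch_div_self
  refine ⟨?_, hright, ?_⟩
  · have hid : Tendsto (fun θ : ℝ => θ) (𝓝[>] 0) (𝓝 0) := nhdsWithin_le_nhds
    have hmul := hright.mul hid
    rw [mul_zero] at hmul
    refine hmul.congr' ?_
    filter_upwards [self_mem_nhdsWithin] with θ hθ
    exact div_mul_cancel₀ _ (ne_of_gt hθ)
  · have hreflect : Tendsto (fun θ : ℝ => 2 * π - θ) (𝓝[<] (2 * π)) (𝓝[>] 0) := by
      refine tendsto_nhdsWithin_iff.mpr ⟨?_, ?_⟩
      · have hcont : Continuous fun θ : ℝ => 2 * π - θ := by fun_prop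
        simpa using (hcont.tendsto (2 * π)).mono_left nhdsWithin_le_nhds
      · filter_upwards [self_mem_nhdsWithin] with θ hθ
        exact sub_pos.mpr (Set.mem_Iio.mp hθ)
    have hleft := (hright.comp hreflect).neg
    rw [neg_neg] at hleft
    refine hleft.congr fun θ => ?_
    rw [Function.comp_apply, pTouch_two_pi_sub, ← div_neg, neg_sub]
end

section
/- Let p : ℝ → ℝ be twice continuously differentiable and fix θ ∈ (0, π). For ε ∈ ℝ, define x(ε, θ) = (1 + ε p(θ)) cos θ and y(ε, θ) = (1 + ε p(θ)) sin θ, and define the mean curvature of the corresponding surface of revolution by H(ε, θ) = (x' y'' − x'' y') / (2 (x'² + y'²)^{3/2}) − (x'/y) / (2 √(x'² + y'²)), where primes denote partial derivatives in θ. Then ε ↦ H(ε, θ) is differentiable at ε = 0 with H(0, θ) = 1 and ∂_ε H(ε, θ)|_{ε=0} = −(1/2)(p''(θ) + p'(θ) cot θ + 2 p(θ)). -/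
open Real
open scoped Real

/-- Derivative of a radial perturbation `(1 + ε p) g` of the function `g`. -/
lemma hasDerivAt_one_add_mul_mul {p g : ℝ → ℝ} {p' g' t : ℝ} (ε : ℝ)
    (hp : HasDerivAt p p' t) (hg : HasDerivAt g g' t) :
    HasDerivAt (fun t => (1 + ε * p t) * g t) (ε * p' * g t + (1 + ε * p t) * g') t :=
  ((hp.const_mul ε).const_add 1).mul hg

/-- First derivative of a radial perturbation `(1 + ε p) g` of the function `g`. -/
lemma deriv_one_add_mul_mul {p g g' : ℝ → ℝ} (ε : ℝ) (hp : Differentiable ℝ p)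
    (hg : ∀ t, HasDerivAt g (g' t) t) :
    deriv (fun t => (1 + ε * p t) * g t) =
      fun t => ε * deriv p t * g t + (1 + ε * p t) * g' t :=
  funext fun t => (hasDerivAt_one_add_mul_mul ε (hp t).hasDerivAt (hg t)).deriv

/-- Second derivative of a radial perturbation `(1 + ε p) g` of the function `g`. -/
lemma deriv_deriv_one_add_mul_mul {p g g' g'' : ℝ → ℝ} (ε : ℝ) (hp : Differentiable ℝ p)
    (hp' : Differentiable ℝ (deriv p)) (hg : ∀ t, HasDerivAt g (g' t) t)
    (hg' : ∀ t, HasDerivAt g' (g'' t) t) (t : ℝ) :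
    deriv (deriv fun t => (1 + ε * p t) * g t) t =
      ε * deriv (deriv p) t * g t + 2 * (ε * deriv p t * g' t) + (1 + ε * p t) * g'' t := by
  rw [deriv_one_add_mul_mul ε hp hg]
  refine ((((hp' t).hasDerivAt.const_mul ε).mul (hg t)).add
    (hasDerivAt_one_add_mul_mul ε (hp t).hasDerivAt (hg' t))).deriv.trans ?_
  ring

/-- Linearization at `ε = 0` of the mean curvature in terms of the values `a`, `b`, `d` of
`p`, `p'`, `p''` and of `c = cos θ`, `s = sin θ`. -/
lemma hasDerivAt_meanCurvature_radial (a b d c s : ℝ) (hs : s ≠ 0) :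
    HasDerivAt (fun ε : ℝ =>
      ((1 + ε * a) ^ 2 + 2 * (ε * b) ^ 2 - (1 + ε * a) * (ε * d)) /
        (2 * ((1 + ε * a) ^ 2 + (ε * b) ^ 2) ^ ((3 : ℝ) / 2))
      - ((ε * b * c - (1 + ε * a) * s) / ((1 + ε * a) * s)) /
        (2 * √((1 + ε * a) ^ 2 + (ε * b) ^ 2)))
      (-(1 / 2) * (d + b * (c / s) + 2 * a)) 0 := by
  have hlin (k : ℝ) : HasDerivAt (fun ε : ℝ => ε * k) k 0 := by
    simpa using (hasDerivAt_id (0 : ℝ)).mul_const k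
  have hr : HasDerivAt (fun ε : ℝ => 1 + ε * a) a 0 := (hlin a).const_add 1
  have hW : HasDerivAt (fun ε : ℝ => (1 + ε * a) ^ 2 + (ε * b) ^ 2) (2 * a) 0 := by
    simpa using (hr.fun_pow 2).fun_add ((hlin b).fun_pow 2)
  have hN : HasDerivAt
      (fun ε : ℝ => (1 + ε * a) ^ 2 + 2 * (ε * b) ^ 2 - (1 + ε * a) * (ε * d))
      (2 * a - d) 0 := by
    simpa using ((hr.fun_pow 2).fun_add (((hlin b).fun_pow 2).const_mul 2)).fun_sub
      (hr.fun_mul (hlin d))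
  have hA : HasDerivAt
      (fun ε : ℝ => (ε * b * c - (1 + ε * a) * s) / ((1 + ε * a) * s)) (b * c / s) 0 := by
    refine ((((hlin b).mul_const c).fun_sub (hr.mul_const s)).fun_div (hr.mul_const s)
      (by simpa using hs)).congr_deriv ?_
    field_simp
    ring
  have hP := (hW.rpow_const (p := (3 : ℝ) / 2) (Or.inl (by simp))).const_mul 2
  have hS := (hW.sqrt (by simp)).const_mul 2
  refine ((hN.fun_div hP (by simp)).fun_sub (hA.fun_div hS (by simp))).congr_deriv ?_
  simp [hs]
  field_simp
  ring

/-- For the perturbed meridian `(x,y)(ε,θ) = (1 + εp(θ))(cos θ, sin θ)`,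
`θ ∈ (0,π)`, of the unit sphere, the mean curvature
`H = (x'y'' − x''y')/(2(x'² + y'²)^{3/2}) − (x'/y)/(2√(x'² + y'²))` (primes denoting
`θ`-derivatives) satisfies `H(0,θ) = 1` and is differentiable in `ε` at `ε = 0` with
`∂_ε H|₀ = −(1/2)(p''(θ) + p'(θ) cot θ + 2p(θ))`. -/
theorem meridian_mean_curvature_linearization (p : ℝ → ℝ) (hp : ContDiff ℝ 2 p)
    (θ : ℝ) (hθ : θ ∈ Set.Ioo (0:ℝ) π)
    (X Y : ℝ → ℝ → ℝ)
    (hX : X = fun ε t => (1 + ε * p t) * Real.cos t)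
    (hY : Y = fun ε t => (1 + ε * p t) * Real.sin t)
    (H : ℝ → ℝ)
    (hH : H = fun ε =>
      (deriv (X ε) θ * deriv (deriv (Y ε)) θ - deriv (deriv (X ε)) θ * deriv (Y ε) θ) /
        (2 * ((deriv (X ε) θ)^2 + (deriv (Y ε) θ)^2) ^ ((3:ℝ)/2))
      - (deriv (X ε) θ / Y ε θ) / (2 * Real.sqrt ((deriv (X ε) θ)^2 + (deriv (Y ε) θ)^2))) :
    H 0 = 1 ∧
    HasDerivAt H
      (-(1/2) * (deriv (deriv p) θ + deriv p θ * (Real.cos θ / Real.sin θ) + 2 * p θ)) 0 := by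
  have hs : Real.sin θ ≠ 0 := (Real.sin_pos_of_pos_of_lt_pi hθ.1 hθ.2).ne'
  have hp₁ : Differentiable ℝ p := hp.differentiable (by norm_num)
  have hp₂ : Differentiable ℝ (deriv p) :=
    ((contDiff_succ_iff_deriv (n := 1)).1 hp).2.2.differentiable (by norm_num)
  have key : H = fun ε : ℝ =>
      ((1 + ε * p θ) ^ 2 + 2 * (ε * deriv p θ) ^ 2 - (1 + ε * p θ) * (ε * deriv (deriv p) θ)) /
        (2 * ((1 + ε * p θ) ^ 2 + (ε * deriv p θ) ^ 2) ^ ((3 : ℝ) / 2))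
      - ((ε * deriv p θ * Real.cos θ - (1 + ε * p θ) * Real.sin θ) /
          ((1 + ε * p θ) * Real.sin θ)) /
        (2 * √((1 + ε * p θ) ^ 2 + (ε * deriv p θ) ^ 2)) := by
    subst hH hX hY
    funext ε
    have hcos := Real.hasDerivAt_cos
    have hsin := Real.hasDerivAt_sin
    have hcos' (t : ℝ) : HasDerivAt (fun t => -Real.sin t) (-Real.cos t) t := (hsin t).fun_neg
    simp only [deriv_deriv_one_add_mul_mul ε hp₁ hp₂ hcos hcos',
      deriv_deriv_one_add_mul_mul ε hp₁ hp₂ hsin hcos]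
    simp only [deriv_one_add_mul_mul ε hp₁ hcos, deriv_one_add_mul_mul ε hp₁ hsin]
    have hcs := Real.sin_sq_add_cos_sq θ
    generalize Real.sin θ = s at *
    generalize Real.cos θ = c at *
    generalize p θ = a
    generalize deriv p θ = b
    generalize deriv (deriv p) θ = d
    congr 2
    · linear_combination ((1 + ε * a) ^ 2 + 2 * (ε * b) ^ 2 - (1 + ε * a) * (ε * d)) * hcs
    · congr 2
      linear_combination ((1 + ε * a) ^ 2 + (ε * b) ^ 2) * hcs
    · ring
    · congr 2
      linear_combination ((1 + ε * a) ^ 2 + (ε * b) ^ 2) * hcs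
  rw [key]
  refine ⟨?_, hasDerivAt_meanCurvature_radial _ _ _ _ _ hs⟩
  simp [neg_div, hs]
  norm_num
end

section
/- Define q : (0, π) → ℝ by 72 q(θ) = 10 √(5 − 4 cos θ) − 23 + (7 + 6 ln(4/27) − 2 ln(1 − cos θ) + 18 ln(√(5 − 4 cos θ) + 3) − 14 ln(√(5 − 4 cos θ) + 1)) cos θ. Then q is twice differentiable on (0, π) and satisfies q''(θ) + q'(θ) cot θ + 2 q(θ) = 1/(3 √(5 − 4 cos θ)) − 5/36 for all θ ∈ (0, π). -/
open Real
open scoped Real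

/-- First-order shape correction `q` for two touching unit balls in the 3-D liquid
drop model. -/
noncomputable def qTouch (θ : ℝ) : ℝ :=
  (10 * Real.sqrt (5 - 4*Real.cos θ) - 23 +
    (7 + 6*Real.log (4/27) - 2*Real.log (1 - Real.cos θ)
      + 18*Real.log (Real.sqrt (5 - 4*Real.cos θ) + 3)
      - 14*Real.log (Real.sqrt (5 - 4*Real.cos θ) + 1)) * Real.cos θ) / 72

/-- The logarithmic coefficient of `cos θ` in `72 * qTouch θ`. -/
noncomputable def qTouchLog (θ : ℝ) : ℝ :=
  7 + 6*Real.log (4/27) - 2*Real.log (1 - Real.cos θ)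
    + 18*Real.log (Real.sqrt (5 - 4*Real.cos θ) + 3)
    - 14*Real.log (Real.sqrt (5 - 4*Real.cos θ) + 1)

/-- The factor `M s` with `qTouchLog' θ = sin θ * M (√(5 - 4 cos θ))`. -/
noncomputable def qTouchSlope (s : ℝ) : ℝ :=
  (48 - 80*s) / (s * (s^2 - 1) * (s + 3))

lemma cos_lt_one_of_mem_Ioo {θ : ℝ} (hθ : θ ∈ Set.Ioo (0:ℝ) π) : Real.cos θ < 1 := by
  nlinarith [Real.sin_sq_add_cos_sq θ, Real.sin_pos_of_mem_Ioo hθ, Real.cos_le_one θ]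

lemma sqrt_five_sub_sq (θ : ℝ) : Real.sqrt (5 - 4*Real.cos θ) ^ 2 = 5 - 4*Real.cos θ :=
  Real.sq_sqrt (by linarith [Real.cos_le_one θ])

lemma one_lt_sqrt_five_sub {θ : ℝ} (hθ : θ ∈ Set.Ioo (0:ℝ) π) :
    1 < Real.sqrt (5 - 4*Real.cos θ) := by
  rw [Real.lt_sqrt one_pos.le]
  linarith [cos_lt_one_of_mem_Ioo hθ]

lemma hasDerivAt_sqrt_five_sub (θ : ℝ) :
    HasDerivAt (fun t => Real.sqrt (5 - 4*Real.cos t))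
      (2 * Real.sin θ / Real.sqrt (5 - 4*Real.cos θ)) θ := by
  have hpos : 5 - 4*Real.cos θ ≠ 0 := by linarith [Real.cos_le_one θ]
  convert (((Real.hasDerivAt_cos θ).const_mul 4).const_sub 5).sqrt hpos using 1
  have := Real.sqrt_ne_zero'.2 (show 0 < 5 - 4*Real.cos θ by linarith [Real.cos_le_one θ])
  field_simp
  ring

lemma hasDerivAt_qTouchLog {θ : ℝ} (hθ : θ ∈ Set.Ioo (0:ℝ) π) :
    HasDerivAt qTouchLog
      (Real.sin θ * qTouchSlope (Real.sqrt (5 - 4*Real.cos θ))) θ := by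
  have hs := one_lt_sqrt_five_sub hθ
  have hsq := sqrt_five_sub_sq θ
  have hd := hasDerivAt_sqrt_five_sub θ
  have h1 : 1 - Real.cos θ ≠ 0 := by linarith [cos_lt_one_of_mem_Ioo hθ]
  have h := (((((Real.hasDerivAt_cos θ).const_sub 1).log h1).const_mul 2).const_sub
    (7 + 6*Real.log (4/27))).add (((hd.add_const 3).log (by linarith)).const_mul 18) |>.sub
    (((hd.add_const 1).log (by linarith)).const_mul 14)
  refine h.congr_deriv ?_
  unfold qTouchSlope
  have hc : Real.cos θ = (5 - Real.sqrt (5 - 4*Real.cos θ) ^ 2) / 4 := by linarith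
  generalize Real.sqrt (5 - 4*Real.cos θ) = s at *
  have hm : s ^ 2 - 1 ≠ 0 := by nlinarith
  have hc' : 1 - Real.cos θ = (s ^ 2 - 1) / 4 := by linarith
  rw [hc']
  have h3 : s + 3 ≠ 0 := by linarith
  have h4 : s + 1 ≠ 0 := by linarith
  have h0 : s ≠ 0 := by linarith
  field_simp
  ring

lemma hasDerivAt_qTouchSlope {s : ℝ} (hs : 1 < s) :
    HasDerivAt qTouchSlope
      ((-80 * (s * (s^2 - 1) * (s + 3)) - (48 - 80*s) * (4*s^3 + 9*s^2 - 2*s - 3))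
        / (s * (s^2 - 1) * (s + 3))^2) s := by
  have hm : 0 < s ^ 2 - 1 := by nlinarith
  have hne : s * (s^2 - 1) * (s + 3) ≠ 0 := by positivity
  have hid := hasDerivAt_id' s
  have h := ((hid.const_mul 80).const_sub 48).div
    ((hid.mul ((hid.pow 2).sub_const 1)).mul (hid.add_const 3)) hne
  refine h.congr_deriv ?_
  simp only [Pi.mul_apply, Pi.pow_apply]
  congr 1
  push_cast
  ring

/-- The derivative of `qTouch` on `(0, π)`. -/
noncomputable def qTouchDeriv (θ : ℝ) : ℝ :=
  Real.sin θ * (20 / Real.sqrt (5 - 4*Real.cos θ) - qTouchLog θ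
    + Real.cos θ * qTouchSlope (Real.sqrt (5 - 4*Real.cos θ))) / 72

lemma qTouch_eq (θ : ℝ) : qTouch θ =
    (10 * Real.sqrt (5 - 4*Real.cos θ) - 23 + qTouchLog θ * Real.cos θ) / 72 := by
  rw [qTouch, qTouchLog]

lemma hasDerivAt_qTouch {θ : ℝ} (hθ : θ ∈ Set.Ioo (0:ℝ) π) :
    HasDerivAt qTouch (qTouchDeriv θ) θ := by
  have h := ((((hasDerivAt_sqrt_five_sub θ).const_mul 10).sub_const 23).add
    ((hasDerivAt_qTouchLog hθ).mul (Real.hasDerivAt_cos θ))).div_const 72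
  rw [funext qTouch_eq]
  refine h.congr_deriv ?_
  unfold qTouchDeriv
  ring

/-- `q` is twice differentiable on `(0, π)` and satisfies the ODE
`q'' + q' cot θ + 2q = 1/(3√(5 − 4cos θ)) − 5/36` there. -/
theorem qTouch_ode : ∀ θ ∈ Set.Ioo (0:ℝ) π,
    DifferentiableAt ℝ qTouch θ ∧
    DifferentiableAt ℝ (deriv qTouch) θ ∧
    deriv (deriv qTouch) θ + deriv qTouch θ * (Real.cos θ / Real.sin θ) + 2 * qTouch θ
      = 1/(3*Real.sqrt (5 - 4*Real.cos θ)) - 5/36 := by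
  intro θ hθ
  have hs := one_lt_sqrt_five_sub hθ
  have hsq := sqrt_five_sub_sq θ
  have hd := hasDerivAt_sqrt_five_sub θ
  have heq : deriv qTouch =ᶠ[nhds θ] qTouchDeriv := by
    filter_upwards [isOpen_Ioo.mem_nhds hθ] with t ht using (hasDerivAt_qTouch ht).deriv
  have hM := (hasDerivAt_qTouchSlope hs).comp θ hd
  have h2 := ((Real.hasDerivAt_sin θ).mul
    ((((hasDerivAt_const θ (20:ℝ)).div hd (by linarith)).sub (hasDerivAt_qTouchLog hθ)).add
      ((Real.hasDerivAt_cos θ).mul hM))).div_const 72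
  have h2' := h2.congr_of_eventuallyEq heq
  refine ⟨(hasDerivAt_qTouch hθ).differentiableAt, h2'.differentiableAt, ?_⟩
  rw [h2'.deriv, (hasDerivAt_qTouch hθ).deriv, qTouch_eq]
  simp only [qTouchDeriv, Pi.mul_apply, Pi.add_apply, Pi.sub_apply, Pi.div_apply,
    Function.comp_apply, qTouchSlope]
  have hsin : Real.sin θ ≠ 0 := (Real.sin_pos_of_mem_Ioo hθ).ne'
  have hsc := Real.sin_sq θ
  have hc : Real.cos θ = (5 - Real.sqrt (5 - 4*Real.cos θ) ^ 2) / 4 := by linarith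
  generalize Real.sqrt (5 - 4*Real.cos θ) = s at *
  generalize qTouchLog θ = L at *
  generalize Real.sin θ = σ at *
  generalize Real.cos θ = x at *
  have hm : s ^ 2 - 1 ≠ 0 := by nlinarith
  have h3 : s + 3 ≠ 0 := by linarith
  have h0 : s ≠ 0 := by linarith
  subst hc
  field_simp
  linear_combination (432 * (4 * (s^2 - 1) * (s + 3) *
      (-40 * (s^2 - 1) * (s + 3) - 2 * s^2 * (48 - 80*s)) + 2 * (5 - s^2) *
      (-80 * s * (s^2 - 1) * (s + 3) - (48 - 80*s) * (4*s^3 + 9*s^2 - 2*s - 3)))) * hsc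
end

section
/- Define q : (0, π) → ℝ by 72 q(θ) = 10 √(5 − 4 cos θ) − 23 + (7 + 6 ln(4/27) − 2 ln(1 − cos θ) + 18 ln(√(5 − 4 cos θ) + 3) − 14 ln(√(5 − 4 cos θ) + 1)) cos θ. Then lim_{θ→0⁺} q(θ)/ln θ = −1/18; that is, q(θ) diverges logarithmically as −(1/18) ln θ near the touching point θ = 0. -/
open Real Filter
open scoped Real Topology

/-- The cardinal sine splits the quadratic vanishing off `1 - cos`. -/
theorem one_sub_cos_eq_sq_mul_sinc_sq (θ : ℝ) :
    1 - Real.cos θ = θ ^ 2 * (Real.sinc (θ / 2) ^ 2 / 2) := by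
  rcases eq_or_ne θ 0 with rfl | h
  · simp
  · have hcos : Real.cos θ = 1 - 2 * Real.sin (θ / 2) ^ 2 := by
      have h₂ := Real.cos_two_mul (θ / 2)
      rw [mul_div_cancel₀ θ two_ne_zero] at h₂
      linarith [Real.sin_sq_add_cos_sq (θ / 2)]
    rw [Real.sinc_of_ne_zero (by positivity), hcos]
    field_simp
    ring

/-- The part of `qTouch` that stays continuous at the touching point. -/
noncomputable def qTouchRegular (θ : ℝ) : ℝ :=
  (10 * Real.sqrt (5 - 4 * Real.cos θ) - 23 +
    (7 + 6 * Real.log (4 / 27) - 2 * Real.log (Real.sinc (θ / 2) ^ 2 / 2)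
      + 18 * Real.log (Real.sqrt (5 - 4 * Real.cos θ) + 3)
      - 14 * Real.log (Real.sqrt (5 - 4 * Real.cos θ) + 1)) * Real.cos θ) / 72

theorem continuousAt_qTouchRegular : ContinuousAt qTouchRegular 0 := by
  have hsinc : ContinuousAt (fun θ : ℝ => Real.log (Real.sinc (θ / 2) ^ 2 / 2)) 0 := by
    refine ContinuousAt.log ?_ (by simp)
    have := Real.continuous_sinc
    fun_prop
  have hlog (c : ℝ) (hc : 0 < c) :
      ContinuousAt (fun θ : ℝ => Real.log (Real.sqrt (5 - 4 * Real.cos θ) + c)) 0 :=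
    ContinuousAt.log (by fun_prop) (by positivity)
  have h₃ := hlog 3 (by norm_num)
  have h₁ := hlog 1 (by norm_num)
  unfold qTouchRegular
  fun_prop

theorem qTouch_eq_regular_sub_log {θ : ℝ} (h : θ ≠ 0) (hs : Real.sinc (θ / 2) ≠ 0) :
    qTouch θ = qTouchRegular θ - 1 / 18 * Real.cos θ * Real.log θ := by
  have hlog : Real.log (1 - Real.cos θ)
      = 2 * Real.log θ + Real.log (Real.sinc (θ / 2) ^ 2 / 2) := by
    rw [one_sub_cos_eq_sq_mul_sinc_sq, Real.log_mul (by positivity) (by positivity),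
      Real.log_pow]
    norm_num
  rw [qTouch, qTouchRegular, hlog]
  ring

/-- `q(θ)/ln θ → −1/18` as `θ → 0⁺`, i.e. `q` diverges logarithmically
like `−(1/18) ln θ` near the touching point. -/
theorem qTouch_log_singularity :
    Tendsto (fun θ => qTouch θ / Real.log θ) (𝓝[>] (0:ℝ)) (𝓝 (-(1/18))) := by
  have hreg : Tendsto (fun θ => qTouchRegular θ / Real.log θ) (𝓝[>] (0:ℝ)) (𝓝 0) :=
    (continuousAt_qTouchRegular.tendsto.mono_left nhdsWithin_le_nhds).div_atBot
      Real.tendsto_log_nhdsGT_zero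
  have hcos : Tendsto (fun θ => 1 / 18 * Real.cos θ) (𝓝[>] (0:ℝ)) (𝓝 (1 / 18)) := by
    have hc : Continuous fun θ : ℝ => 1 / 18 * Real.cos θ := by fun_prop
    simpa using (hc.tendsto 0).mono_left nhdsWithin_le_nhds
  have hsinc : ∀ᶠ θ in 𝓝[>] (0:ℝ), Real.sinc (θ / 2) ≠ 0 := by
    have hc : Continuous fun θ : ℝ => Real.sinc (θ / 2) :=
      Real.continuous_sinc.comp (continuous_id.div_const 2)
    exact (hc.continuousAt.eventually_ne (by simp)).filter_mono nhdsWithin_le_nhds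
  have hlim := hreg.sub hcos
  rw [zero_sub] at hlim
  refine hlim.congr' ?_
  filter_upwards [self_mem_nhdsWithin, hsinc,
    Real.tendsto_log_nhdsGT_zero.eventually_ne_atBot 0] with θ hθ hs hl
  rw [qTouch_eq_regular_sub_log (ne_of_gt hθ) hs, sub_div, mul_div_cancel_right₀ _ hl]
end

section
/- For x > 0 and y > 0 define H(x, y) = x y (ln(x² + y²) − 3) + x² arctan(y/x) + y² arctan(x/y). Then the mixed second partial derivative satisfies ∂²H/∂x∂y (x, y) = ln(x² + y²) for all x > 0, y > 0. -/
open Real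
open scoped Real

/-- The explicit double antiderivative `H(x,y) = xy(ln(x²+y²) − 3) + x² arctan(y/x)
+ y² arctan(x/y)` of the 2-D logarithmic kernel. -/
noncomputable def Hker (x y : ℝ) : ℝ :=
  x * y * (Real.log (x^2 + y^2) - 3) + x^2 * Real.arctan (y/x) + y^2 * Real.arctan (x/y)

theorem hasDerivAt_Hker_snd {x y : ℝ} (hx : x ≠ 0) (hy : y ≠ 0) :
    HasDerivAt (fun y' => Hker x y')
      (x * (Real.log (x ^ 2 + y ^ 2) - 2) + 2 * y * Real.arctan (x / y)) y := by
  have hr : x ^ 2 + y ^ 2 ≠ 0 := by positivity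
  have hlog := (((hasDerivAt_id y).pow 2).const_add (x ^ 2)).log hr
  have hyx := ((hasDerivAt_id y).div_const x).arctan
  have hxy := ((hasDerivAt_const y x).div (hasDerivAt_id y) hy).arctan
  have h := ((((hasDerivAt_id y).const_mul x).mul (hlog.sub_const 3)).add
    (hyx.const_mul (x ^ 2))).add (((hasDerivAt_id y).pow 2).mul hxy)
  refine h.congr_deriv ?_
  simp only [id, Pi.pow_apply, Pi.div_apply]
  field_simp
  ring

theorem hasDerivAt_mul_log_add_arctan (x : ℝ) {y : ℝ} (hy : y ≠ 0) :
    HasDerivAt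
      (fun x' => x' * (Real.log (x' ^ 2 + y ^ 2) - 2) + 2 * y * Real.arctan (x' / y))
      (Real.log (x ^ 2 + y ^ 2)) x := by
  have hr : x ^ 2 + y ^ 2 ≠ 0 := by positivity
  have hlog := (((hasDerivAt_id x).pow 2).add_const (y ^ 2)).log hr
  have hxy := ((hasDerivAt_id x).div_const y).arctan
  have h := ((hasDerivAt_id x).mul (hlog.sub_const 2)).add (hxy.const_mul (2 * y))
  refine h.congr_deriv ?_
  simp only [id, Pi.pow_apply]
  field_simp
  ring

/-- for `x > 0`, `y > 0`, the mixed second partial derivative of `H`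
is the logarithmic kernel: `∂²H/∂x∂y = ln(x² + y²)`. -/
theorem Hker_mixed_partial (x y : ℝ) (hx : 0 < x) (hy : 0 < y) :
    deriv (fun x' => deriv (fun y' => Hker x' y') y) x = Real.log (x^2 + y^2) := by
  refine ((hasDerivAt_mul_log_add_arctan x hy.ne').congr_of_eventuallyEq ?_).deriv
  filter_upwards [eventually_ne_nhds hx.ne'] with x' hx'
  exact (hasDerivAt_Hker_snd hx' hy.ne').deriv
end
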